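/- arXiv:1202.4594 — 3 statements merged into one kernel-verified Lean document; each statement's English description precedes it below -/
import Mathlib

section
/- Let R be a unital *-ring, r ≥ 1 a natural number, and s, v ∈ R elements satisfying s*·s = 1, v·s = s^r·v, and s*·v = s^{r−1}·v·s*. Then s commutes with the element ∑_{j=0}^{r−1} s^j·v·v*·(s*)^j, i.e. s·( ∑_{j=0}^{r−1} s^j·v·v*·(s*)^j ) = ( ∑_{j=0}^{r−1} s^j·v·v*·(s*)^j )·s. -/
/-- In a unital *-ring, if `s* s = 1`, `v s = s^r v` and
`s* v = s^{r-1} v s*`, then `s` commutes with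
`∑_{j=0}^{r-1} s^j v v* (s*)^j`. -/
theorem commutes_with_alpha_r_one
    {R : Type*} [Ring R] [StarRing R] (r : ℕ) (hr : 1 ≤ r) (s v : R)
    (h1 : star s * s = 1)
    (h2 : v * s = s ^ r * v)
    (h3 : star s * v = s ^ (r - 1) * v * star s) :
    s * (∑ j ∈ Finset.range r, s ^ j * v * star v * (star s) ^ j) =
      (∑ j ∈ Finset.range r, s ^ j * v * star v * (star s) ^ j) * s := by
  obtain ⟨n, rfl⟩ := Nat.exists_eq_add_of_le' hr
  rw [Nat.add_sub_cancel] at h3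
  have h4 : star v * s = s * (star v * star s ^ n) := by
    simpa [mul_assoc] using congrArg star h3
  have hend : v * star v * s = s ^ (n + 1) * v * star v * star s ^ n := by
    rw [mul_assoc, h4, ← mul_assoc, h2, ← mul_assoc]
  rw [Finset.mul_sum, Finset.sum_mul, Finset.sum_range_succ, Finset.sum_range_succ']
  congr 1
  · refine Finset.sum_congr rfl fun j _ => ?_
    rw [pow_succ (star s), mul_assoc _ _ s, mul_assoc _ (star s) s, h1, mul_one, pow_succ' s]
    simp only [mul_assoc]
  · rw [pow_zero, pow_zero, one_mul, mul_one, hend, pow_succ' s]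
    simp only [mul_assoc]
end

section
/- Let R be a unital *-ring, r ≥ 1 a natural number, and s, v ∈ R elements satisfying s*·s = 1, v·s = s^r·v, and s*·v = s^{r−1}·v·s*. Then for every natural number k with 1 ≤ k ≤ r one has v*·s^k·(s*)^k = s·s*·v*. -/
/-- If `s` is an isometry with `s* v = s^{r-1} v s*`, then `(s*)^k v = s^{r-k} v s*` for
`1 ≤ k ≤ r`. -/
theorem star_pow_mul_eq_pow_sub_mul_mul_star {R : Type*} [Monoid R] [StarMul R] {r : ℕ} {s v : R}
    (h1 : star s * s = 1) (h3 : star s * v = s ^ (r - 1) * v * star s) {k : ℕ}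
    (hk : 1 ≤ k) (hkr : k ≤ r) :
    star s ^ k * v = s ^ (r - k) * v * star s := by
  induction k, hk using Nat.le_induction with
  | base => simpa using h3
  | succ n hn ih =>
    rw [pow_succ', mul_assoc, ih (by omega), show r - n = (r - (n + 1)) + 1 by omega, pow_succ']
    simp only [← mul_assoc, h1, one_mul]


/-- In a unital *-ring, if `s* s = 1`, `v s = s^r v` and
`s* v = s^{r-1} v s*`, then for `1 ≤ k ≤ r` one has
`v* s^k (s*)^k = s s* v*`. -/
theorem vstar_mul_range_projection
    {R : Type*} [Ring R] [StarRing R] (r : ℕ) (hr : 1 ≤ r) (s v : R)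
    (h1 : star s * s = 1)
    (h2 : v * s = s ^ r * v)
    (h3 : star s * v = s ^ (r - 1) * v * star s) :
    ∀ k : ℕ, 1 ≤ k → k ≤ r →
      star v * s ^ k * (star s) ^ k = s * star s * star v := by
  intro k hk hkr
  have h : s ^ k * star s ^ k * v = v * s * star s := by
    rw [mul_assoc, star_pow_mul_eq_pow_sub_mul_mul_star h1 h3 hk hkr, ← mul_assoc, ← mul_assoc,
      ← pow_add, Nat.add_sub_cancel' hkr, h2]
  simpa [mul_assoc] using congrArg star h
end

section
/- Let R be a unital *-ring, r ≥ 1 a natural number, and s, v ∈ R elements satisfying s*·s = 1, v·s = s^r·v, and s*·v = s^{r−1}·v·s*. Assume in addition that v*·(s*)^m·v = 0 for every positive integer m not divisible by r. Then for all natural numbers k ≤ l with k ≤ r and with l − k not divisible by r, one has v*·s^k·(s*)^l·v = 0. -/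
/-- If `a * b = 1` then `a ^ (m + n) * b ^ n = a ^ m`. -/
theorem pow_add_mul_pow_of_mul_eq_one {M : Type*} [Monoid M] {a b : M} (h : a * b = 1)
    (m n : ℕ) : a ^ (m + n) * b ^ n = a ^ m := by
  induction n with
  | zero => simp
  | succ n ih =>
    rw [← add_assoc, pow_succ, pow_succ', mul_assoc, ← mul_assoc a b, h, one_mul, ih]


/-- In a unital *-ring, if `s* s = 1`, `v s = s^r v`,
`s* v = s^{r-1} v s*`, and `v* (s*)^m v = 0` whenever `r ∤ m`, `m > 0`,
then `v* s^k (s*)^l v = 0` for all `k ≤ l` with `k ≤ r` and `r ∤ (l - k)`. -/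
theorem vstar_monomial_v_eq_zero
    {R : Type*} [Ring R] [StarRing R] (r : ℕ) (hr : 1 ≤ r) (s v : R)
    (h1 : star s * s = 1)
    (h2 : v * s = s ^ r * v)
    (h3 : star s * v = s ^ (r - 1) * v * star s)
    (h5 : ∀ m : ℕ, 0 < m → ¬ r ∣ m → star v * (star s) ^ m * v = 0) :
    ∀ k l : ℕ, k ≤ l → k ≤ r → ¬ r ∣ (l - k) →
      star v * s ^ k * (star s) ^ l * v = 0 := by
  intro k l hkl hkr hdvd
  obtain ⟨d, rfl⟩ := Nat.exists_eq_add_of_le hkl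
  rw [Nat.add_sub_cancel_left] at hdvd
  cases k with
  | zero =>
    have hd : 0 < d := Nat.pos_of_ne_zero fun h => hdvd (h ▸ dvd_zero r)
    simpa using h5 d hd hdvd
  | succ k =>
    have h_star : star v * s = s * (star v * star s ^ (r - 1)) := by
      simpa [mul_assoc] using congrArg star h3
    have h_cancel : star s ^ (r - 1) * s ^ k = star s ^ (r - (k + 1)) := by
      rw [← pow_add_mul_pow_of_mul_eq_one h1 (r - (k + 1)) k]
      congr 2
      omega
    have h_move : star v * s ^ (k + 1) = s * (star v * star s ^ (r - (k + 1))) := by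
      rw [pow_succ', ← mul_assoc, h_star, mul_assoc, mul_assoc, h_cancel]
    have h_exp : r - (k + 1) + (k + 1 + d) = r + d := by omega
    have h_zero := h5 (r + d) (by omega) (by rwa [Nat.dvd_add_right (dvd_refl r)])
    rw [h_move, mul_assoc s, mul_assoc (star v), ← pow_add, h_exp, mul_assoc, h_zero, mul_zero]
end
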